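/- arXiv:2503.05259 — 2 statements merged into one kernel-verified Lean document; each statement's English description precedes it below -/
import Mathlib

section
/- Let G₅ be the subgroup of G₇ generated by t and u, let Z₅ = {1, z², z⁴, z⁶, z⁸, z¹⁰}, U = {1, u, u²}, and X₅ = {1, t·u·t⁻¹, t·u, t·u²}. Then X₅ = (X₇ ∪ z·X₇) ∩ G₅ where X₇ = {1, s, s·u, s·u·s}, and the map Z₅ × U × X₅ → G₅ sending (y, v, x) to y·v·x is a bijection onto G₅. -/
open Pointwise

namespace Tetra

def rels : Set (FreeGroup (Fin 3)) :=
  { FreeGroup.of 0 ^ 2, FreeGroup.of 1 ^ 3, FreeGroup.of 2 ^ 3,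
    FreeGroup.of 0 * FreeGroup.of 1 * FreeGroup.of 2 *
      (FreeGroup.of 1 * FreeGroup.of 2 * FreeGroup.of 0)⁻¹,
    FreeGroup.of 0 * FreeGroup.of 1 * FreeGroup.of 2 *
      (FreeGroup.of 2 * FreeGroup.of 0 * FreeGroup.of 1)⁻¹ }

/-- The group `G₇ = ⟨s, t, u | s² = t³ = u³ = 1, stu = tus = ust⟩`. -/
abbrev G7 := PresentedGroup rels

def s : G7 := PresentedGroup.of 0
def t : G7 := PresentedGroup.of 1
def u : G7 := PresentedGroup.of 2
def z : G7 := s * t * u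

def G5 : Subgroup G7 := Subgroup.closure {t, u}

theorem s_sq : s * s = 1 := by
  have h := PresentedGroup.one_of_mem (rels := rels) (x := FreeGroup.of 0 ^ 2) (by simp [rels])
  rw [pow_two, map_mul] at h
  exact h

theorem t_cube : t * t * t = 1 := by
  have h := PresentedGroup.one_of_mem (rels := rels) (x := FreeGroup.of 1 ^ 3) (by simp [rels])
  rw [pow_succ, pow_two, map_mul, map_mul] at h
  exact h

theorem u_cube : u * u * u = 1 := by
  have h := PresentedGroup.one_of_mem (rels := rels) (x := FreeGroup.of 2 ^ 3) (by simp [rels])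
  rw [pow_succ, pow_two, map_mul, map_mul] at h
  exact h

theorem z_eq1 : z = t * u * s := by
  have h := PresentedGroup.mk_eq_mk_of_mul_inv_mem (rels := rels)
    (x := FreeGroup.of 0 * FreeGroup.of 1 * FreeGroup.of 2)
    (y := FreeGroup.of 1 * FreeGroup.of 2 * FreeGroup.of 0) (by simp [rels])
  simp only [map_mul] at h
  exact h

theorem z_eq2 : z = u * s * t := by
  have h := PresentedGroup.mk_eq_mk_of_mul_inv_mem (rels := rels)
    (x := FreeGroup.of 0 * FreeGroup.of 1 * FreeGroup.of 2)
    (y := FreeGroup.of 2 * FreeGroup.of 0 * FreeGroup.of 1) (by simp [rels])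
  simp only [map_mul] at h
  exact h

theorem zs : s * z = z * s := by
  conv_lhs => rw [z_eq1]
  simp [z, mul_assoc]

theorem zu : u * z = z * u := by
  conv_rhs => rw [z_eq2]
  simp [z, mul_assoc]

theorem u_inv : u⁻¹ = u * u := by
  rw [inv_eq_iff_mul_eq_one, ← mul_assoc, u_cube]

theorem t_inv : t⁻¹ = t * t := by
  rw [inv_eq_iff_mul_eq_one, ← mul_assoc, t_cube]

theorem s_inv : s⁻¹ = s := by
  rw [inv_eq_iff_mul_eq_one, s_sq]

theorem ss (a : G7) : s * (s * a) = a := by rw [← mul_assoc, s_sq, one_mul]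
theorem uuu (a : G7) : u * (u * (u * a)) = a := by
  rw [← mul_assoc, ← mul_assoc, u_cube, one_mul]
theorem zs' (a : G7) : s * (z * a) = z * (s * a) := by rw [← mul_assoc, zs, mul_assoc]
theorem zu' (a : G7) : u * (z * a) = z * (u * a) := by rw [← mul_assoc, zu, mul_assoc]
theorem uuu0 : u * (u * u) = 1 := by rw [← mul_assoc, u_cube]

theorem t_eq : t = z * (s * (u * u)) := by
  rw [← u_inv, ← mul_assoc, ← zs]
  simp only [z, mul_assoc, mul_inv_cancel, mul_one, ss]

theorem braid : u * (s * (u * (s * (u * s)))) = z * (z * z) := by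
  have h := t_cube
  rw [t_eq] at h
  simp only [mul_assoc, zs', zu'] at h
  have h2 : u * (s * (u * (s * (u * s)))) = z * (z * (z * (s * (u * (u * (s * (u * (u * (s * (u * u)))))))))) *
      (u * (s * (u * (s * (u * s))))) := by rw [h, one_mul]
  rw [h2]
  simp only [mul_assoc, uuu, ss, s_sq, mul_one]

theorem susu : s * (u * (s * u)) = z * (z * (z * (u * (u * s)))) := by
  have h := congrArg (fun a => u * (u * (a * s))) braid
  simpa only [mul_assoc, uuu, ss, s_sq, mul_one, zu', zu, zs', zs] using h

theorem suu : z * (z * (z * (s * (u * u)))) = u * (s * (u * s)) := by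
  have h := congrArg (fun a => a * (s * (u * u))) braid
  simp only [mul_assoc, ss, uuu0, mul_one] at h
  exact h.symm

theorem z12 : z ^ 12 = 1 := by
  -- `c = z ^ 3`; `b = u s u⁻¹`, `(b s)² = c⁻²` and `(s b)² = c⁻²`
  have key : z ^ 6 * ((u * s * u⁻¹) * s * (u * s * u⁻¹) * s) = 1 := by
    have hd : u * u * s * (u * u)⁻¹ = z ^ 3 * (u * s * u⁻¹ * s) := by
      have e : (u * u)⁻¹ = u := by rw [← u_inv, inv_inv]
      rw [e, u_inv]
      simp only [mul_assoc, pow_succ, pow_zero, one_mul]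
      have h := congrArg (fun a => u * (a * s)) suu
      simp only [mul_assoc, zu', s_sq, mul_one] at h
      rw [h]
    have h1 : (u * u * s * (u * u)⁻¹) * (u * u * s * (u * u)⁻¹) = 1 := by
      calc _ = u * u * (s * s) * (u * u)⁻¹ := by group
        _ = 1 := by rw [s_sq]; group
    rw [hd, u_inv] at h1
    rw [u_inv]
    simpa only [mul_assoc, pow_succ, pow_zero, one_mul, zs', zu'] using h1
  have c6s : s * z ^ 6 = z ^ 6 * s := (Commute.pow_right (show Commute s z from zs) 6).eq
  have key2 : z ^ 6 * (s * (u * s * u⁻¹) * s * (u * s * u⁻¹)) = 1 := by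
    calc _ = (z ^ 6 * s) * ((u * s * u⁻¹) * s * (u * s * u⁻¹)) := by group
      _ = s * (z ^ 6 * ((u * s * u⁻¹) * s * (u * s * u⁻¹) * s)) * s⁻¹ := by rw [← c6s]; group
      _ = 1 := by rw [key]; group
  have prod : ((u * s * u⁻¹) * s * (u * s * u⁻¹) * s) * (s * (u * s * u⁻¹) * s * (u * s * u⁻¹)) = 1 := by
    rw [u_inv]
    simp only [mul_assoc, ss, uuu, uuu0, mul_one]
  have e1 := eq_inv_of_mul_eq_one_right key
  have e2 := eq_inv_of_mul_eq_one_right key2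
  rw [e1, e2, ← mul_inv_rev, inv_eq_one, ← pow_add] at prod
  exact prod

theorem zz_eq : z ^ 2 = t * u * t * u := by
  have h1 : t * u = z * s := by rw [t_eq]; simp only [mul_assoc, uuu0, mul_one]
  rw [mul_assoc (t * u), h1]
  simp only [mul_assoc, zs', s_sq, mul_one, pow_two]

theorem tu_eq : t * u = z * s := by rw [t_eq]; simp only [mul_assoc, uuu0, mul_one]
theorem tuu_eq : t * u ^ 2 = z * (s * u) := by
  rw [pow_two, ← mul_assoc, tu_eq, mul_assoc]
theorem tut_eq : t * u * t⁻¹ = s * u * s := by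
  rw [mul_inv_eq_iff_eq_mul, tu_eq, t_eq]
  simp only [mul_assoc, zs', zu', ss, uuu0, mul_one, zs]

def X5 : Set G7 := {1, t * u * t⁻¹, t * u, t * u ^ 2}

def NF (g : G7) : Prop := ∃ k j : ℕ, ∃ x ∈ X5, g = z ^ (2 * k) * u ^ j * x

theorem nf_mul {g : G7} (h : NF g) (a : G7) (ha : ∀ x ∈ X5, NF (x * a)) : NF (g * a) := by
  obtain ⟨k, j, x, hx, rfl⟩ := h
  obtain ⟨k', j', x', hx', e⟩ := ha x hx
  refine ⟨k + k', j + j', x', hx', ?_⟩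
  rw [mul_assoc, e, mul_add, pow_add, pow_add]
  have hc : u ^ j * z ^ (2 * k') = z ^ (2 * k') * u ^ j :=
    (Commute.pow_pow (show Commute u z from zu) _ _).eq
  calc _ = z ^ (2 * k) * (u ^ j * z ^ (2 * k')) * u ^ j' * x' := by group
    _ = _ := by rw [hc]; simp only [mul_assoc]

theorem t_nf : t = z ^ 10 * (u * (s * (u * s))) := by
  rw [t_eq, ← suu]
  have := z12
  calc _ = z ^ 12 * (z * (s * (u * u))) := by rw [z12, one_mul]
    _ = _ := by simp only [pow_succ, pow_zero, one_mul, mul_assoc]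

theorem nf_u (x : G7) (hx : x ∈ X5) : NF (x * u) := by
  rcases hx with rfl | rfl | rfl | rfl
  · exact ⟨0, 1, 1, by simp [X5], by simp⟩
  · refine ⟨1, 2, t * u, by simp [X5], ?_⟩
    rw [tut_eq, tu_eq]
    simp only [mul_assoc, susu, pow_succ, pow_zero, one_mul, zu', zs', Nat.mul_one]
  · exact ⟨0, 0, t * u ^ 2, by simp [X5], by simp [pow_two, mul_assoc]⟩
  · refine ⟨5, 1, t * u * t⁻¹, by simp [X5], ?_⟩
    rw [pow_two, mul_assoc, u_cube, mul_one, tut_eq, pow_one, mul_assoc, mul_assoc s]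
    exact t_nf

theorem nf_t (x : G7) (hx : x ∈ X5) : NF (x * t) := by
  rcases hx with rfl | rfl | rfl | rfl
  · refine ⟨5, 1, t * u * t⁻¹, by simp [X5], ?_⟩
    rw [one_mul, tut_eq, pow_one, mul_assoc, mul_assoc s]
    exact t_nf
  · exact ⟨0, 0, t * u, by simp [X5], by simp⟩
  · refine ⟨1, 2, 1, by simp [X5], ?_⟩
    rw [tu_eq, t_eq]
    simp only [mul_assoc, ss, pow_succ, pow_zero, one_mul, zu', zs', Nat.mul_one, mul_one]
  · refine ⟨2, 2, t * u ^ 2, by simp [X5], ?_⟩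
    rw [tuu_eq, t_eq]
    have h := congrArg (fun a => a * u) susu
    simp only [mul_assoc] at h
    simp only [mul_assoc, h, pow_succ, pow_zero, one_mul, zu', zs', Nat.reduceMul]

theorem nf_G5 (g : G7) (hg : g ∈ G5) : NF g := by
  induction hg using Subgroup.closure_induction_right with
  | one => exact ⟨0, 0, 1, by simp [X5], by simp⟩
  | mul_right x hx y hy ih =>
    rcases hy with rfl | rfl
    · exact nf_mul ih _ nf_t
    · exact nf_mul ih _ nf_u
  | mul_inv_cancel x hx y hy ih =>
    rcases hy with rfl | rfl
    · rw [t_inv, ← mul_assoc]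
      exact nf_mul (nf_mul ih _ nf_t) _ nf_t
    · rw [u_inv, ← mul_assoc]
      exact nf_mul (nf_mul ih _ nf_u) _ nf_u

/-- The sign-type character sending `s` to the generator of `ℤ/2`. -/
def chi : G7 →* Multiplicative (ZMod 2) :=
  PresentedGroup.toGroup (f := ![Multiplicative.ofAdd 1, 1, 1]) (by
    intro r hr
    rcases hr with rfl | rfl | rfl | rfl | rfl <;> simp <;> decide)

theorem chi_s : chi s = Multiplicative.ofAdd 1 := PresentedGroup.toGroup.of _
theorem chi_t : chi t = 1 := PresentedGroup.toGroup.of _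
theorem chi_u : chi u = 1 := PresentedGroup.toGroup.of _

theorem chi_G5 (g : G7) (hg : g ∈ G5) : chi g = 1 := by
  have : G5 ≤ chi.ker := by
    rw [G5, Subgroup.closure_le]
    rintro x (rfl | rfl)
    · exact chi_t
    · exact chi_u
  exact this hg

def permS : Equiv.Perm (Fin 4) := Equiv.swap 0 1 * Equiv.swap 2 3
def permU : Equiv.Perm (Fin 4) := Equiv.swap 0 1 * Equiv.swap 1 2
def permT : Equiv.Perm (Fin 4) := permS * permU * permU

/-- The quotient onto the tetrahedral group `A₄`. -/
def alt : G7 →* Equiv.Perm (Fin 4) :=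
  PresentedGroup.toGroup (f := ![permS, permT, permU]) (by
    intro r hr
    rcases hr with rfl | rfl | rfl | rfl | rfl <;> simp <;> decide)

theorem alt_s : alt s = permS := PresentedGroup.toGroup.of _
theorem alt_t : alt t = permT := PresentedGroup.toGroup.of _
theorem alt_u : alt u = permU := PresentedGroup.toGroup.of _
theorem alt_z : alt z = 1 := by
  rw [z, map_mul, map_mul, alt_s, alt_t, alt_u]; decide

abbrev M := Matrix (Fin 2) (Fin 2) (ZMod 13)
def matS : Mˣ := ⟨!![1, 0; 0, 12], !![1, 0; 0, 12], by decide, by decide⟩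
def matT : Mˣ := ⟨!![12, 8; 12, 5], !![12, 8; 12, 5] * !![12, 8; 12, 5], by decide, by decide⟩
def matU : Mˣ := ⟨!![12, 1; 5, 5], !![12, 1; 5, 5] * !![12, 1; 5, 5], by decide, by decide⟩

/-- The reflection representation reduced modulo 13. -/
def refl13 : G7 →* Mˣ :=
  PresentedGroup.toGroup (f := ![matS, matT, matU]) (by
    intro r hr
    rcases hr with rfl | rfl | rfl | rfl | rfl <;> simp <;> decide)

theorem refl13_s : refl13 s = matS := PresentedGroup.toGroup.of _
theorem refl13_t : refl13 t = matT := PresentedGroup.toGroup.of _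
theorem refl13_u : refl13 u = matU := PresentedGroup.toGroup.of _
theorem refl13_z : refl13 z = matS * matT * matU := by
  rw [z, map_mul, map_mul, refl13_s, refl13_t, refl13_u]

theorem z_inj : ∀ k k' : Fin 6, z ^ (2 * k.val) = z ^ (2 * k'.val) → k = k' := by
  intro k k' h
  have h2 := congrArg refl13 h
  rw [map_pow, map_pow, refl13_z, pow_mul, pow_mul] at h2
  have e : (((matS * matT * matU) ^ 2 : Mˣ) : M) = Matrix.scalar (Fin 2) 4 := by decide
  have h3 := congrArg (fun m : Mˣ => (m : M) 0 0) h2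
  simp only [Units.val_pow_eq_pow_val] at h3 e
  rw [e, ← map_pow, ← map_pow] at h3
  simp only [Matrix.scalar_apply, Matrix.diagonal_apply_eq] at h3
  revert h3
  clear h h2 e
  revert k k'
  decide

def x5 : Fin 4 → G7 := ![1, t * u * t⁻¹, t * u, t * u ^ 2]
def px5 : Fin 4 → Equiv.Perm (Fin 4) :=
  ![1, permT * permU * permT⁻¹, permT * permU, permT * permU ^ 2]

theorem alt_x5 (i : Fin 4) : alt (x5 i) = px5 i := by
  fin_cases i <;> simp [x5, px5, alt_t, alt_u]

theorem px5_inj : ∀ j j' : Fin 3, ∀ i i' : Fin 4,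
    permU ^ j.val * px5 i = permU ^ j'.val * px5 i' → j = j' ∧ i = i' := by
  decide

theorem mem_Z {y : G7} : y ∈ ({1, z ^ 2, z ^ 4, z ^ 6, z ^ 8, z ^ 10} : Set G7) ↔
    ∃ k : Fin 6, y = z ^ (2 * k.val) := by
  simp [Fin.exists_fin_succ]

theorem mem_U {y : G7} : y ∈ ({1, u, u ^ 2} : Set G7) ↔ ∃ k : Fin 3, y = u ^ k.val := by
  simp [Fin.exists_fin_succ]

theorem mem_X {y : G7} : y ∈ ({1, t * u * t⁻¹, t * u, t * u ^ 2} : Set G7) ↔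
    ∃ i : Fin 4, y = x5 i := by
  simp [Fin.exists_fin_succ, x5]

theorem t_mem : t ∈ G5 := Subgroup.subset_closure (by simp)
theorem u_mem : u ∈ G5 := Subgroup.subset_closure (by simp)

theorem x5_mem {x : G7} (hx : x ∈ ({1, t * u * t⁻¹, t * u, t * u ^ 2} : Set G7)) : x ∈ G5 := by
  rcases hx with rfl | rfl | rfl | rfl
  · exact G5.one_mem
  · exact G5.mul_mem (G5.mul_mem t_mem u_mem) (G5.inv_mem t_mem)
  · exact G5.mul_mem t_mem u_mem
  · exact G5.mul_mem t_mem (G5.pow_mem u_mem 2)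

theorem zz_mem : z ^ 2 ∈ G5 := by
  rw [zz_eq]
  exact G5.mul_mem (G5.mul_mem (G5.mul_mem t_mem u_mem) t_mem) u_mem

theorem chi_ne {g : G7} (h : chi g = Multiplicative.ofAdd 1) : g ∉ G5 := by
  intro hg
  rw [chi_G5 g hg] at h
  revert h
  decide

theorem chi_z : chi z = Multiplicative.ofAdd 1 := by
  rw [z, map_mul, map_mul, chi_s, chi_t, chi_u]; rfl

theorem statement5 :
    ({1, t * u * t⁻¹, t * u, t * u ^ 2} : Set G7) =
      (({1, s, s * u, s * u * s} : Set G7) ∪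
        z • ({1, s, s * u, s * u * s} : Set G7)) ∩ (G5 : Set G7) ∧
    Set.BijOn (fun p : G7 × G7 × G7 => p.1 * p.2.1 * p.2.2)
      (({1, z ^ 2, z ^ 4, z ^ 6, z ^ 8, z ^ 10} : Set G7) ×ˢ (({1, u, u ^ 2} : Set G7) ×ˢ ({1, t * u * t⁻¹, t * u, t * u ^ 2} : Set G7)))
      (G5 : Set G7) := by
  refine ⟨?_, ?_, ?_, ?_⟩
  · ext g
    constructor
    · intro hg
      refine ⟨?_, x5_mem hg⟩
      rcases hg with rfl | rfl | rfl | rfl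
      · left; simp
      · left; rw [tut_eq]; simp
      · right; rw [tu_eq]; exact Set.smul_mem_smul_set (by simp)
      · right; rw [tuu_eq]; exact Set.smul_mem_smul_set (by simp)
    · rintro ⟨hg | ⟨g, hg, rfl⟩, h5⟩
      · rcases hg with rfl | rfl | rfl | rfl
        · simp
        · exact absurd h5 (chi_ne chi_s)
        · exact absurd h5 (chi_ne (by rw [map_mul, chi_s, chi_u]; rfl))
        · rw [← tut_eq]; simp
      · simp only [smul_eq_mul] at h5 ⊢
        rcases hg with rfl | rfl | rfl | rfl
        · exact absurd h5 (chi_ne (by rw [mul_one, chi_z]))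
        · rw [← tu_eq]; simp
        · rw [← tuu_eq]; simp
        · exact absurd h5 (chi_ne (by simp only [map_mul, chi_s, chi_u, chi_z]; decide))
  · rintro ⟨y, v, x⟩ ⟨hy, hv, hx⟩
    obtain ⟨k, hk⟩ := mem_Z.1 hy
    obtain ⟨j, hj⟩ := mem_U.1 hv
    simp only at hk hj hx
    subst hk hj
    refine G5.mul_mem (G5.mul_mem ?_ (G5.pow_mem u_mem _)) (x5_mem hx)
    rw [pow_mul]
    exact G5.pow_mem zz_mem _
  · rintro ⟨y, v, x⟩ ⟨hy, hv, hx⟩ ⟨y', v', x'⟩ ⟨hy', hv', hx'⟩ h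
    obtain ⟨k, hk⟩ := mem_Z.1 hy
    obtain ⟨j, hj⟩ := mem_U.1 hv
    obtain ⟨i, hi⟩ := mem_X.1 hx
    obtain ⟨k', hk'⟩ := mem_Z.1 hy'
    obtain ⟨j', hj'⟩ := mem_U.1 hv'
    obtain ⟨i', hi'⟩ := mem_X.1 hx'
    simp only at hk hj hi hk' hj' hi' h
    subst hk hj hi hk' hj' hi'
    have ha := congrArg alt h
    simp only [map_mul, map_pow, alt_z, alt_u, alt_x5, one_pow, one_mul] at ha
    obtain ⟨rfl, rfl⟩ := px5_inj _ _ _ _ ha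
    have hz := z_inj k k' (mul_right_cancel (mul_right_cancel h))
    rw [hz]
  · intro g hg
    obtain ⟨k, j, x, hx, rfl⟩ := nf_G5 g hg
    refine ⟨(z ^ (2 * (k % 6)), u ^ (j % 3), x), ⟨?_, ?_, hx⟩, ?_⟩
    · exact mem_Z.2 ⟨⟨k % 6, Nat.mod_lt _ (by norm_num)⟩, rfl⟩
    · exact mem_U.2 ⟨⟨j % 3, Nat.mod_lt _ (by norm_num)⟩, rfl⟩
    · have h1 : z ^ (2 * (k % 6)) = z ^ (2 * k) := by
        rw [pow_mul, pow_mul]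
        exact (pow_eq_pow_mod k (by rw [← pow_mul]; exact z12)).symm
      have h2 : u ^ (j % 3) = u ^ j :=
        (pow_eq_pow_mod j (by rw [pow_succ, pow_two]; exact u_cube)).symm
      simp only [h1, h2]

end Tetra
end

section
/- In G₁₁, the element z = s·t·u is central, has order 24, and the center of G₁₁ is exactly the cyclic subgroup generated by z (so Z(G₁₁) = {1, z, z², …, z²³}). -/
open Pointwise

namespace Octa

def rels : Set (FreeGroup (Fin 3)) :=
  { FreeGroup.of 0 ^ 2, FreeGroup.of 1 ^ 3, FreeGroup.of 2 ^ 4,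
    FreeGroup.of 0 * FreeGroup.of 1 * FreeGroup.of 2 *
      (FreeGroup.of 1 * FreeGroup.of 2 * FreeGroup.of 0)⁻¹,
    FreeGroup.of 0 * FreeGroup.of 1 * FreeGroup.of 2 *
      (FreeGroup.of 2 * FreeGroup.of 0 * FreeGroup.of 1)⁻¹ }

/-- The group `G₁₁ = ⟨s, t, u | s² = t³ = u⁴ = 1, stu = tus = ust⟩`. -/
abbrev G11 := PresentedGroup rels

def s : G11 := PresentedGroup.of 0
def t : G11 := PresentedGroup.of 1
def u : G11 := PresentedGroup.of 2
def z : G11 := s * t * u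

/-- Images of `s`, `t` in the symmetric group. -/
def pA : Equiv.Perm (Fin 4) := Equiv.swap 0 1
def pB : Equiv.Perm (Fin 4) := Equiv.swap 1 2 * Equiv.swap 2 3

theorem normal_form {Q : Type*} [Group Q] (a b : Q) (ha : a * a = 1) (hb : b * b * b = 1)
    (hab : a * b * (a * b) * (a * b) * (a * b) = 1) (hcl : Subgroup.closure {a, b} = ⊤) (x : Q) :
    ∃ k : ℤ, ∃ c ∈ ({1, a, b, b * a, b * a * b, b * a * b * b} : Set Q), x = (a * b) ^ k * c := by
  have hai : a⁻¹ = a := inv_eq_of_mul_eq_one_left ha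
  have hbi : b⁻¹ = b * b := inv_eq_of_mul_eq_one_left hb
  have key : b * a * b * a = (a * b) * (b * a * b * b) := by
    have h1 : (b * a) * (b * a) * ((b * a) * (b * a)) = 1 := by
      have : (b * a) * (b * a) * ((b * a) * (b * a))
          = a⁻¹ * (a * b * (a * b) * (a * b) * (a * b)) * a := by group
      rw [this, hab]; simp
    have h2 := eq_inv_of_mul_eq_one_left h1
    simp only [mul_inv_rev, hai, hbi] at h2
    simpa only [mul_assoc] using h2
  have stepA : ∀ x : Q, (∃ k : ℤ, ∃ c ∈ ({1, a, b, b * a, b * a * b, b * a * b * b} : Set Q),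
      x = (a * b) ^ k * c) → ∃ k : ℤ, ∃ c ∈ ({1, a, b, b * a, b * a * b, b * a * b * b} : Set Q),
      x * a = (a * b) ^ k * c := by
    rintro x ⟨k, c, hc, rfl⟩
    simp only [Set.mem_insert_iff, Set.mem_singleton_iff] at hc
    rcases hc with h | h | h | h | h | h <;> rw [h]
    · exact ⟨k, a, by simp, by simp⟩
    · exact ⟨k, 1, by simp, by rw [mul_assoc, ha]⟩
    · exact ⟨k, b * a, by simp, by simp [mul_assoc]⟩
    · exact ⟨k, b, by simp, by simp [mul_assoc, ha]⟩
    · exact ⟨k + 1, b * a * b * b, by simp, by rw [mul_assoc, key, zpow_add_one]; group⟩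
    · refine ⟨k - 1, b * a * b, by simp, ?_⟩
      have : b * a * b = (a * b) * (b * a * b * b) * a := by
        rw [← key, mul_assoc _ a a, ha, mul_one]
      conv_rhs => rw [this]
      rw [zpow_sub_one]; group
  have stepB : ∀ x : Q, (∃ k : ℤ, ∃ c ∈ ({1, a, b, b * a, b * a * b, b * a * b * b} : Set Q),
      x = (a * b) ^ k * c) → ∃ k : ℤ, ∃ c ∈ ({1, a, b, b * a, b * a * b, b * a * b * b} : Set Q),
      x * b = (a * b) ^ k * c := by
    rintro x ⟨k, c, hc, rfl⟩
    simp only [Set.mem_insert_iff, Set.mem_singleton_iff] at hc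
    rcases hc with h | h | h | h | h | h <;> rw [h]
    · exact ⟨k, b, by simp, by simp⟩
    · exact ⟨k + 1, 1, by simp, by rw [zpow_add_one]; group⟩
    · refine ⟨k - 1, a, by simp, ?_⟩
      rw [zpow_sub_one, mul_inv_rev, mul_assoc, ← hbi, hai, mul_assoc, mul_assoc, ha, mul_one]
    · exact ⟨k, b * a * b, by simp, by simp [mul_assoc]⟩
    · exact ⟨k, b * a * b * b, by simp, by simp [mul_assoc]⟩
    · refine ⟨k, b * a, by simp, ?_⟩
      have : b * a * b * b * b = b * a * (b * b * b) := by group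
      rw [mul_assoc, this, hb, mul_one]
  have hx : x ∈ Subgroup.closure {a, b} := by rw [hcl]; trivial
  induction hx using Subgroup.closure_induction_right with
  | one => exact ⟨0, 1, by simp, by simp⟩
  | mul_right x y _ hy ih =>
    rcases hy with rfl | rfl
    · exact stepA _ ih
    · exact stepB _ ih
  | mul_inv_cancel x y _ hy ih =>
    rcases hy with rfl | rfl
    · rw [hai]; exact stepA _ ih
    · rw [hbi, ← mul_assoc]; exact stepB _ (stepB _ ih)

theorem inj_of_rels {Q : Type*} [Group Q] (a b : Q) (ha : a * a = 1) (hb : b * b * b = 1)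
    (hab : a * b * (a * b) * (a * b) * (a * b) = 1) (hcl : Subgroup.closure {a, b} = ⊤)
    (f : Q →* Equiv.Perm (Fin 4)) (hfa : f a = pA) (hfb : f b = pB) (x : Q) (hx : f x = 1) :
    x = 1 := by
  obtain ⟨k, c, hc, rfl⟩ := normal_form a b ha hb hab hcl x
  have h4 : (a * b) ^ (4 : ℤ) = 1 := by rw [← hab]; simp [zpow_ofNat, pow_succ]
  have hk : (a * b) ^ k = (a * b) ^ (k % 4) := by
    conv_lhs => rw [← Int.emod_add_mul_ediv k 4, zpow_add, zpow_mul, h4, one_zpow, mul_one]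
  rw [hk] at hx ⊢
  have h0 := Int.emod_nonneg k (show (4 : ℤ) ≠ 0 by norm_num)
  have h1 := Int.emod_lt_of_pos k (show (0 : ℤ) < 4 by norm_num)
  generalize k % 4 = m at *
  simp only [Set.mem_insert_iff, Set.mem_singleton_iff] at hc
  rcases hc with rfl | rfl | rfl | rfl | rfl | rfl <;> interval_cases m <;>
    simp only [map_mul, map_zpow, map_one, hfa, hfb] at hx <;>
    first
    | (exfalso; revert hx; decide)
    | simp

theorem rel_s : s * s = 1 := by
  have := PresentedGroup.one_of_mem (rels := rels) (x := FreeGroup.of 0 ^ 2) (by simp [rels])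
  simp only [pow_two, one_mul, pow_zero, map_mul, pow_one] at this
  exact this

theorem rel_t : t * t * t = 1 := by
  have := PresentedGroup.one_of_mem (rels := rels) (x := FreeGroup.of 1 ^ 3) (by simp [rels])
  simp only [pow_succ, one_mul, pow_zero, map_mul, pow_one] at this
  exact this

theorem rel_u : u ^ 4 = 1 := by
  have := PresentedGroup.one_of_mem (rels := rels) (x := FreeGroup.of 2 ^ 4) (by simp [rels])
  exact this

theorem rel_z1 : z = t * u * s := by
  have := PresentedGroup.mk_eq_mk_of_mul_inv_mem (rels := rels)
    (x := FreeGroup.of 0 * FreeGroup.of 1 * FreeGroup.of 2)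
    (y := FreeGroup.of 1 * FreeGroup.of 2 * FreeGroup.of 0) (by simp [rels])
  exact this

theorem rel_z2 : z = u * s * t := by
  have := PresentedGroup.mk_eq_mk_of_mul_inv_mem (rels := rels)
    (x := FreeGroup.of 0 * FreeGroup.of 1 * FreeGroup.of 2)
    (y := FreeGroup.of 2 * FreeGroup.of 0 * FreeGroup.of 1) (by simp [rels])
  exact this

theorem cl_stu : Subgroup.closure ({s, t, u} : Set G11) = ⊤ := by
  rw [← PresentedGroup.closure_range_of rels]
  congr 1
  ext x
  simp only [Set.mem_insert_iff, Set.mem_singleton_iff, Set.mem_range, Fin.exists_fin_succ]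
  simp [s, t, u, eq_comm]

theorem z_central : z ∈ Subgroup.center G11 := by
  have hs : s * z = z * s := by
    conv_lhs => rw [rel_z1]
    rw [z]; group
  have hu : u * z = z * u := by
    conv_rhs => rw [rel_z2]
    rw [z]; group
  have ht : t * z = z * t := by
    conv_lhs => rw [rel_z2]
    rw [rel_z1]; group
  rw [← Subgroup.centralizer_univ, ← Subgroup.coe_top, ← cl_stu, Subgroup.centralizer_closure,
    Subgroup.mem_centralizer_iff]
  rintro g (rfl | rfl | rfl) <;> assumption

def toPerm : G11 →* Equiv.Perm (Fin 4) :=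
  PresentedGroup.toGroup (rels := rels) (f := ![pA, pB, (pA * pB)⁻¹]) (by
    intro r hr
    simp only [rels, Set.mem_insert_iff, Set.mem_singleton_iff] at hr
    rcases hr with rfl | rfl | rfl | rfl | rfl <;> simp <;> decide)


theorem toPerm_s : toPerm s = pA := by simp [toPerm, s]
theorem toPerm_t : toPerm t = pB := by simp [toPerm, t]
theorem toPerm_u : toPerm u = (pA * pB)⁻¹ := by simp [toPerm, u]
theorem toPerm_z : toPerm z = 1 := by simp [z, toPerm_s, toPerm_t, toPerm_u]

instance zNormal : (Subgroup.zpowers z).Normal :=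
  ⟨fun n hn g => by
    have h := Subgroup.mem_center_iff.1 (Subgroup.zpowers_le.2 z_central hn) g
    rwa [h, mul_inv_cancel_right]⟩

theorem ker_eq : toPerm.ker = Subgroup.zpowers z := by
  have hle : Subgroup.zpowers z ≤ toPerm.ker := by
    rw [Subgroup.zpowers_le]; exact toPerm_z
  refine le_antisymm ?_ hle
  intro g hg
  let q : G11 →* G11 ⧸ Subgroup.zpowers z := QuotientGroup.mk' _
  have hz : q s * q t * q u = 1 := by
    rw [← map_mul, ← map_mul]
    exact (QuotientGroup.eq_one_iff _).2 (Subgroup.mem_zpowers z)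
  have hqu : q u = (q s * q t)⁻¹ := eq_inv_of_mul_eq_one_right hz
  have h4 : (q s * q t) ^ 4 = 1 := by
    rw [← inv_inj, ← inv_pow, ← hqu, ← map_pow, rel_u]; simp
  have hcl : Subgroup.closure {q s, q t} = ⊤ := by
    have h := congrArg (Subgroup.map q) cl_stu
    rw [MonoidHom.map_closure, Subgroup.map_top_of_surjective q (QuotientGroup.mk'_surjective _)] at h
    rw [eq_top_iff, ← h, Subgroup.closure_le]
    have h1 : q s ∈ Subgroup.closure {q s, q t} := Subgroup.subset_closure (by simp)
    have h2 : q t ∈ Subgroup.closure {q s, q t} := Subgroup.subset_closure (by simp)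
    rintro _ ⟨x, rfl | rfl | rfl, rfl⟩
    · exact h1
    · exact h2
    · rw [hqu]; exact inv_mem (mul_mem h1 h2)
  have := inj_of_rels (q s) (q t) (by rw [← map_mul, rel_s, map_one])
    (by rw [← map_mul, ← map_mul, rel_t, map_one]) (by rw [← h4]; simp [pow_succ]) hcl
    (QuotientGroup.lift _ toPerm hle) toPerm_s toPerm_t (q g) hg
  exact (QuotientGroup.eq_one_iff _).1 this

theorem perm_center : ∀ σ : Equiv.Perm (Fin 4), σ * pA = pA * σ → σ * pB = pB * σ → σ = 1 := by
  decide

theorem center_eq : Subgroup.center G11 = Subgroup.zpowers z := by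
  refine le_antisymm ?_ (Subgroup.zpowers_le.2 z_central)
  intro g hg
  rw [← ker_eq]
  rw [Subgroup.mem_center_iff] at hg
  apply perm_center
  · rw [← toPerm_s, ← map_mul, ← map_mul, hg]
  · rw [← toPerm_t, ← map_mul, ← map_mul, hg]

theorem index_dvd : (Subgroup.center G11).index ∣ 24 := by
  rw [center_eq, ← ker_eq, Subgroup.index_ker]
  have h : Nat.card (Equiv.Perm (Fin 4)) = 24 := by
    rw [Nat.card_perm, Nat.card_fin]; rfl
  rw [← h]
  exact Subgroup.card_subgroup_dvd_card _

theorem z_pow : z ^ 24 = 1 := by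
  obtain ⟨m, hm⟩ := index_dvd
  have : (Subgroup.center G11).FiniteIndex := ⟨by rintro h; simp [h] at hm⟩
  have hT : ∀ g : G11, g ^ 24 = 1 → (MonoidHom.transferCenterPow G11 g) ^ m = 1 := by
    intro g hg
    apply Subtype.ext
    rw [Subgroup.coe_pow, MonoidHom.transferCenterPow_apply, ← pow_mul, ← hm, hg]; rfl
  have hs : s ^ 24 = 1 := by
    rw [show 24 = 2 * 12 from rfl, pow_mul, pow_two, rel_s, one_pow]
  have ht : t ^ 24 = 1 := by
    rw [show 24 = 3 * 8 from rfl, pow_mul, pow_succ t, pow_two, rel_t, one_pow]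
  have hu : u ^ 24 = 1 := by
    rw [show 24 = 4 * 6 from rfl, pow_mul, rel_u, one_pow]
  have h : (MonoidHom.transferCenterPow G11 z) ^ m = 1 := by
    have hc : ∀ a b : Subgroup.center G11, Commute a b := fun a b =>
      Subtype.ext (Subgroup.mem_center_iff.1 b.2 a)
    rw [z, map_mul, map_mul, (hc _ _).mul_pow, (hc _ _).mul_pow, hT s hs, hT t ht, hT u hu]; simp
  have hfin := congrArg Subtype.val h
  rw [Subgroup.coe_pow, MonoidHom.transferCenterPow_apply, ← pow_mul, ← hm] at hfin
  exact hfin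

/-- The reflection representation reduced modulo 73. -/
def mS : (Matrix (Fin 2) (Fin 2) (ZMod 73))ˣ :=
  ⟨!![1, 0; 0, -1], !![1, 0; 0, -1], by decide, by decide⟩
def mT : (Matrix (Fin 2) (Fin 2) (ZMod 73))ˣ :=
  ⟨!![21, 1; 57, 44], !![60, 65; 55, 22], by decide, by decide⟩
def mU : (Matrix (Fin 2) (Fin 2) (ZMod 73))ˣ :=
  ⟨!![55, 56; 20, 65], !![3, 21; 44, 25], by decide, by decide⟩

def toMat : G11 →* (Matrix (Fin 2) (Fin 2) (ZMod 73))ˣ :=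
  PresentedGroup.toGroup (rels := rels) (f := ![mS, mT, mU]) (by
    intro r hr
    simp only [rels, Set.mem_insert_iff, Set.mem_singleton_iff] at hr
    rcases hr with rfl | rfl | rfl | rfl | rfl <;> simp <;> decide)

theorem toMat_z : toMat z = mS * mT * mU := by simp [z, toMat, s, t, u]

theorem mat_sq : ((mS * mT * mU : (Matrix (Fin 2) (Fin 2) (ZMod 73))ˣ) :
    Matrix (Fin 2) (Fin 2) (ZMod 73)) = Matrix.scalar (Fin 2) (7 : ZMod 73) := by
  decide

theorem z_pow_ne (k : ℕ) (hk : (7 : ZMod 73) ^ k ≠ 1) : z ^ k ≠ 1 := by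
  intro h
  have h1 := congrArg toMat h
  rw [map_pow, toMat_z, map_one] at h1
  have h2 := congrArg Units.val h1
  rw [Units.val_pow_eq_pow_val, mat_sq, ← map_pow, Units.val_one] at h2
  apply hk
  have h3 := congrFun (congrFun h2 0) 0
  simpa using h3

theorem statement8 :
    z ∈ Subgroup.center G11 ∧ orderOf z = 24 ∧
    Subgroup.center G11 = Subgroup.zpowers z := by
  refine ⟨z_central, ?_, center_eq⟩
  apply orderOf_eq_of_pow_and_pow_div_prime (by norm_num) z_pow
  intro p hp hd
  have hdvd : p ∣ 2 ^ 3 * 3 := hd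
  rcases (Nat.Prime.dvd_mul hp).1 hdvd with h | h
  · rw [(Nat.prime_dvd_prime_iff_eq hp Nat.prime_two).1 (hp.dvd_of_dvd_pow h)]
    exact z_pow_ne _ (by decide)
  · rw [(Nat.prime_dvd_prime_iff_eq hp Nat.prime_three).1 h]
    exact z_pow_ne _ (by decide)

end Octa
end
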